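/- Let G = F_2^n, fix finitely supported G-valued random variables X_1^0, X_2^0, set η = 1/9, and define τ[X_1; X_2] := d[X_1; X_2] + η·d[X_1^0; X_1] + η·d[X_2^0; X_2]. Suppose X_1, X_2 are finitely supported G-valued random variables with d[X_1; X_2] = k, satisfying τ[X_1'; X_2'] ≥ τ[X_1; X_2] for every pair of finitely supported G-valued random variables X_1', X_2'. Let X_1, X_2, X̃_1, X̃_2 be jointly independent, with X̃_1 a copy of X_1 and X̃_2 a copy of X_2, and set I_1 := I[X_1 + X_2 : X̃_1 + X_2 | X_1 + X_2 + X̃_1 + X̃_2]. Then H[X_1 + X_2 + X̃_1 + X̃_2] ≤ (1/2)H[X_1] + (1/2)H[X_2] + (2 + η)k − I_1. -/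

import Mathlib

open scoped Classical BigOperators Pointwise
open Finset

noncomputable section

/-- The probability that the random variable `X` equals `s`, under the pmf `μ`. -/
def pmass {Ω S : Type*} [Fintype Ω] (μ : Ω → ℝ) (X : Ω → S) (s : S) : ℝ :=
  ∑ ω, if X ω = s then μ ω else 0

/-- `μ` is a probability mass function on the finite type `Ω`. -/
def IsProb {Ω : Type*} [Fintype Ω] (μ : Ω → ℝ) : Prop :=
  (∀ ω, 0 ≤ μ ω) ∧ ∑ ω, μ ω = 1

/-- Shannon entropy `H[X]` of a random variable `X : Ω → S` under `μ`. -/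
def ent {Ω S : Type*} [Fintype Ω] (μ : Ω → ℝ) (X : Ω → S) : ℝ :=
  ∑ s ∈ Finset.univ.image X, Real.negMulLog (pmass μ X s)

/-- Mutual information `I[X : Y]`. -/
def mutualInfo {Ω S T : Type*} [Fintype Ω] (μ : Ω → ℝ) (X : Ω → S) (Y : Ω → T) : ℝ :=
  ent μ X + ent μ Y - ent μ (fun ω => (X ω, Y ω))

/-- The conditional measure, conditioning on the event `Y = y`. -/
def condMeas {Ω T : Type*} [Fintype Ω] (μ : Ω → ℝ) (Y : Ω → T) (y : T) : Ω → ℝ :=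
  fun ω => if Y ω = y then μ ω / pmass μ Y y else 0

/-- Conditional mutual information `I[X : Y | Z]`. -/
def condMutualInfo {Ω S T U : Type*} [Fintype Ω] (μ : Ω → ℝ)
    (X : Ω → S) (Y : Ω → T) (Z : Ω → U) : ℝ :=
  ∑ z ∈ Finset.univ.image Z, pmass μ Z z * mutualInfo (condMeas μ Z z) X Y

/-- Entropic Ruzsa distance `d[X ; Y]`, defined via independent copies on a product space. -/
def rdist {Ω₁ Ω₂ G : Type*} [Fintype Ω₁] [Fintype Ω₂] [AddCommGroup G]
    (μ₁ : Ω₁ → ℝ) (X : Ω₁ → G) (μ₂ : Ω₂ → ℝ) (Y : Ω₂ → G) : ℝ :=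
  ent (fun p : Ω₁ × Ω₂ => μ₁ p.1 * μ₂ p.2) (fun p => X p.1 - Y p.2)
    - ent μ₁ X / 2 - ent μ₂ Y / 2

/-- Conditional Ruzsa distance `d[X | Z ; Y | W]`. -/
def condRdist {Ω₁ Ω₂ G T U : Type*} [Fintype Ω₁] [Fintype Ω₂] [AddCommGroup G]
    (μ₁ : Ω₁ → ℝ) (X : Ω₁ → G) (Z : Ω₁ → T)
    (μ₂ : Ω₂ → ℝ) (Y : Ω₂ → G) (W : Ω₂ → U) : ℝ :=
  ∑ z ∈ Finset.univ.image Z, ∑ w ∈ Finset.univ.image W,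
    pmass μ₁ Z z * pmass μ₂ W w * rdist (condMeas μ₁ Z z) X (condMeas μ₂ W w) Y

/-- Conditional Ruzsa distance `d[X ; Y | W]`, conditioning only on the right variable. -/
def condRdistRight {Ω₁ Ω₂ G U : Type*} [Fintype Ω₁] [Fintype Ω₂] [AddCommGroup G]
    (μ₁ : Ω₁ → ℝ) (X : Ω₁ → G)
    (μ₂ : Ω₂ → ℝ) (Y : Ω₂ → G) (W : Ω₂ → U) : ℝ :=
  ∑ w ∈ Finset.univ.image W, pmass μ₂ W w * rdist μ₁ X (condMeas μ₂ W w) Y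

/-- The uniform probability mass function on a subset `H` of a finite type. -/
def unifOn {G : Type*} [Fintype G] (H : Set G) : G → ℝ :=
  fun g => if g ∈ H then ((Nat.card H : ℝ))⁻¹ else 0

/-- `X` (under `μ₁`) and `Y` (under `μ₂`) are identically distributed. -/
def IdentDist {Ω₁ Ω₂ S : Type*} [Fintype Ω₁] [Fintype Ω₂]
    (μ₁ : Ω₁ → ℝ) (X : Ω₁ → S) (μ₂ : Ω₂ → ℝ) (Y : Ω₂ → S) : Prop :=
  ∀ s, pmass μ₁ X s = pmass μ₂ Y s

/-- Two random variables are independent. -/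
def IndepPair {Ω S T : Type*} [Fintype Ω] (μ : Ω → ℝ) (X : Ω → S) (Y : Ω → T) : Prop :=
  ∀ s t, pmass μ (fun ω => (X ω, Y ω)) (s, t) = pmass μ X s * pmass μ Y t

/-- Three random variables are jointly independent. -/
def IndepTriple {Ω S T U : Type*} [Fintype Ω] (μ : Ω → ℝ)
    (X : Ω → S) (Y : Ω → T) (Z : Ω → U) : Prop :=
  ∀ s t u, pmass μ (fun ω => (X ω, Y ω, Z ω)) (s, t, u)
    = pmass μ X s * pmass μ Y t * pmass μ Z u

/-- Four random variables are jointly independent. -/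
def IndepFour {Ω S T U V : Type*} [Fintype Ω] (μ : Ω → ℝ)
    (X : Ω → S) (Y : Ω → T) (Z : Ω → U) (W : Ω → V) : Prop :=
  ∀ s t u v, pmass μ (fun ω => (X ω, Y ω, Z ω, W ω)) (s, t, u, v)
    = pmass μ X s * pmass μ Y t * pmass μ Z u * pmass μ W v



section helpers
variable {Ω Ω₁ Ω₂ S T U : Type*} [Fintype Ω] [Fintype Ω₁] [Fintype Ω₂]

theorem pmass_nonneg' {μ : Ω → ℝ} (h : ∀ ω, 0 ≤ μ ω) (X : Ω → S) (s : S) : 0 ≤ pmass μ X s :=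
  Finset.sum_nonneg fun ω _ => by split_ifs <;> simp [h]

theorem pmass_sum [Fintype S] (μ : Ω → ℝ) (X : Ω → S) : ∑ s, pmass μ X s = ∑ ω, μ ω := by
  unfold pmass
  rw [Finset.sum_comm]
  simp

theorem pmass_notMem (μ : Ω → ℝ) (X : Ω → S) (s : S) (h : s ∉ Finset.univ.image X) :
    pmass μ X s = 0 := by
  apply Finset.sum_eq_zero
  intro ω _
  rw [if_neg]
  rintro rfl
  exact h (by simp)

theorem ent_eq [Fintype S] (μ : Ω → ℝ) (X : Ω → S) :
    ent μ X = ∑ s, Real.negMulLog (pmass μ X s) := by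
  unfold ent
  apply Finset.sum_subset (Finset.subset_univ _)
  intro s _ h
  simp [pmass_notMem μ X s h]

theorem ent_eq_omega (μ : Ω → ℝ) (X : Ω → S) :
    ent μ X = ∑ ω, μ ω * (- Real.log (pmass μ X (X ω))) := by
  unfold ent
  have : ∀ s, Real.negMulLog (pmass μ X s)
      = ∑ ω, if X ω = s then μ ω * (- Real.log (pmass μ X s)) else 0 := by
    intro s
    rw [Real.negMulLog]
    nth_rewrite 1 [pmass]
    rw [neg_mul_comm, Finset.sum_mul]
    apply Finset.sum_congr rfl
    intro ω _
    split_ifs <;> simp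
  simp_rw [this]
  rw [Finset.sum_comm]
  apply Finset.sum_congr rfl
  intro ω _
  rw [Finset.sum_ite_eq]
  simp

theorem ent_iff (μ : Ω → ℝ) (X : Ω → S) (Y : Ω → T)
    (h : ∀ ω ω', X ω = X ω' ↔ Y ω = Y ω') : ent μ X = ent μ Y := by
  rw [ent_eq_omega, ent_eq_omega]
  apply Finset.sum_congr rfl
  intro ω _
  have : pmass μ X (X ω) = pmass μ Y (Y ω) := by
    unfold pmass
    apply Finset.sum_congr rfl
    intro ω' _
    simp only [h]
  rw [this]

theorem pmass_comp [Fintype S] (μ : Ω → ℝ) (X : Ω → S) (f : S → T) (t : T) :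
    pmass μ (fun ω => f (X ω)) t = ∑ s, if f s = t then pmass μ X s else 0 := by
  unfold pmass
  have : ∀ s, (if f s = t then ∑ ω, (if X ω = s then μ ω else 0) else 0)
     = ∑ ω, if X ω = s then (if f s = t then μ ω else 0) else 0 := by
    intro s
    split_ifs <;> simp
  simp_rw [this]
  rw [Finset.sum_comm]
  simp

theorem ident_comp [Fintype S] {μ : Ω₁ → ℝ} {ν : Ω₂ → ℝ} {X : Ω₁ → S} {Y : Ω₂ → S}
    (h : IdentDist μ X ν Y) (f : S → T) :
    IdentDist μ (fun ω => f (X ω)) ν (fun ω => f (Y ω)) := by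
  intro t
  rw [pmass_comp, pmass_comp]
  simp only [h _]

theorem ident_ent [Fintype S] {μ : Ω₁ → ℝ} {ν : Ω₂ → ℝ} {X : Ω₁ → S} {Y : Ω₂ → S}
    (h : IdentDist μ X ν Y) : ent μ X = ent ν Y := by
  rw [ent_eq, ent_eq]
  simp only [h _]

theorem pmass_prod (μ : Ω₁ → ℝ) (ν : Ω₂ → ℝ) (X : Ω₁ → S) (Y : Ω₂ → T) (s : S) (t : T) :
    pmass (fun p : Ω₁ × Ω₂ => μ p.1 * ν p.2) (fun p => (X p.1, Y p.2)) (s, t)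
      = pmass μ X s * pmass ν Y t := by
  unfold pmass
  rw [Finset.sum_mul_sum, Fintype.sum_prod_type]
  apply Finset.sum_congr rfl; intro a _
  apply Finset.sum_congr rfl; intro b _
  by_cases h1 : X a = s <;> by_cases h2 : Y b = t <;> simp [h1, h2]

theorem pmass_snd {μ : Ω₁ → ℝ} (hμ : IsProb μ) (ν : Ω₂ → ℝ) (Y : Ω₂ → T) (t : T) :
    pmass (fun p : Ω₁ × Ω₂ => μ p.1 * ν p.2) (fun p => Y p.2) t = pmass ν Y t := by
  unfold pmass
  rw [Fintype.sum_prod_type]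
  simp only [← mul_ite_zero, ← Finset.mul_sum]
  rw [← Finset.sum_mul, hμ.2, one_mul]

theorem isProb_prod {μ : Ω₁ → ℝ} {ν : Ω₂ → ℝ} (h : IsProb μ) (h' : IsProb ν) :
    IsProb (fun p : Ω₁ × Ω₂ => μ p.1 * ν p.2) := by
  refine ⟨fun p => mul_nonneg (h.1 _) (h'.1 _), ?_⟩
  rw [Fintype.sum_prod_type]
  simp only [← Finset.mul_sum]
  rw [h'.2]; simp [h.2]

theorem isProb_cond {μ : Ω → ℝ} (h : IsProb μ) (Z : Ω → U) (z : U) (hz : pmass μ Z z ≠ 0) :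
    IsProb (condMeas μ Z z) := by
  constructor
  · intro ω
    unfold condMeas
    split_ifs
    · exact div_nonneg (h.1 _) (pmass_nonneg' h.1 _ _)
    · exact le_rfl
  · unfold condMeas
    have : ∀ ω, (if Z ω = z then μ ω / pmass μ Z z else 0)
      = (if Z ω = z then μ ω else 0) / pmass μ Z z := by
      intro ω; split_ifs <;> simp
    simp_rw [this]
    rw [← Finset.sum_div]
    exact div_self hz

theorem pmass_pair {μ : Ω → ℝ} (h : ∀ ω, 0 ≤ μ ω) (X : Ω → S) (Z : Ω → U) (x : S) (z : U) :
    pmass μ (fun ω => (X ω, Z ω)) (x, z) = pmass μ Z z * pmass (condMeas μ Z z) X x := by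
  by_cases hz : pmass μ Z z = 0
  · rw [hz, zero_mul]
    have h0 : ∀ ω, Z ω = z → μ ω = 0 := by
      intro ω hω
      have := (Finset.sum_eq_zero_iff_of_nonneg
        (fun ω _ => by split_ifs <;> simp [h])).1 hz ω (Finset.mem_univ _)
      simpa [hω] using this
    apply Finset.sum_eq_zero
    intro ω _
    split_ifs with h1
    · exact h0 ω (Prod.ext_iff.1 h1).2
    · rfl
  · nth_rewrite 3 [pmass]
    rw [Finset.mul_sum, pmass]
    apply Finset.sum_congr rfl
    intro ω _
    unfold condMeas
    by_cases h1 : X ω = x <;> by_cases h2 : Z ω = z <;> simp [h1, h2]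
    field_simp

/-- Conditional entropy. -/
def cE [Fintype U] (μ : Ω → ℝ) (X : Ω → S) (Z : Ω → U) : ℝ :=
  ∑ z, pmass μ Z z * ent (condMeas μ Z z) X

theorem chain [Fintype S] [Fintype U] {μ : Ω → ℝ} (h : IsProb μ) (X : Ω → S) (Z : Ω → U) :
    cE μ X Z = ent μ (fun ω => (X ω, Z ω)) - ent μ Z := by
  rw [eq_sub_iff_add_eq, ent_eq, ent_eq, Fintype.sum_prod_type_right, cE, ← Finset.sum_add_distrib]
  apply Finset.sum_congr rfl
  intro z _
  simp only [pmass_pair h.1, Real.negMulLog_mul]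
  rw [Finset.sum_add_distrib, ← Finset.mul_sum, ← ent_eq, ← Finset.sum_mul, pmass_sum]
  by_cases hz : pmass μ Z z = 0
  · simp [hz]
  · rw [(isProb_cond h Z z hz).2]; ring

theorem pmass_fst_sum [Fintype U] (μ : Ω → ℝ) (X : Ω → S) (Z : Ω → U) (x : S) :
    pmass μ X x = ∑ z, pmass μ (fun ω => (X ω, Z ω)) (x, z) := by
  unfold pmass
  rw [Finset.sum_comm]
  apply Finset.sum_congr rfl
  intro ω _
  by_cases h : X ω = x <;> simp [h]

theorem cE_le [Fintype S] [Fintype U] {μ : Ω → ℝ} (h : IsProb μ) (X : Ω → S) (Z : Ω → U) :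
    cE μ X Z ≤ ent μ X := by
  unfold cE
  simp only [ent_eq, Finset.mul_sum]
  rw [Finset.sum_comm]
  apply Finset.sum_le_sum
  intro x _
  rw [pmass_fst_sum μ X Z x]
  simp only [pmass_pair h.1]
  set q : U → ℝ := fun z => pmass (condMeas μ Z z) X x with hq
  have hq0 : ∀ z, 0 ≤ q z := by
    intro z
    apply pmass_nonneg'
    intro ω
    unfold condMeas
    split_ifs
    · exact div_nonneg (h.1 _) (pmass_nonneg' h.1 _ _)
    · exact le_rfl
  have := Real.concaveOn_negMulLog.le_map_sum (t := Finset.univ) (w := fun z => pmass μ Z z)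
    (p := q) (fun z _ => pmass_nonneg' h.1 _ _) (by rw [pmass_sum, h.2]) (fun z _ => hq0 z)
  simpa [smul_eq_mul] using this

theorem ent_indep [Fintype S] [Fintype T] {μ : Ω → ℝ} (h : IsProb μ) (X : Ω → S) (Y : Ω → T)
    (hi : IndepPair μ X Y) : ent μ (fun ω => (X ω, Y ω)) = ent μ X + ent μ Y := by
  rw [ent_eq, Fintype.sum_prod_type]
  simp only [hi _ _, Real.negMulLog_mul, Finset.sum_add_distrib, ← Finset.mul_sum,
    ← Finset.sum_mul, pmass_sum, h.2, ← ent_eq]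
  ring

theorem condMI [Fintype S] [Fintype T] [Fintype U] {μ : Ω → ℝ} (h : IsProb μ)
    (X : Ω → S) (Y : Ω → T) (Z : Ω → U) :
    condMutualInfo μ X Y Z = ent μ (fun ω => (X ω, Z ω)) + ent μ (fun ω => (Y ω, Z ω))
      - ent μ (fun ω => ((X ω, Y ω), Z ω)) - ent μ Z := by
  have : condMutualInfo μ X Y Z = cE μ X Z + cE μ Y Z - cE μ (fun ω => (X ω, Y ω)) Z := by
    unfold condMutualInfo cE
    rw [Finset.sum_subset (Finset.subset_univ _), ← Finset.sum_add_distrib,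
      ← Finset.sum_sub_distrib]
    · apply Finset.sum_congr rfl
      intro z _
      unfold mutualInfo
      ring
    · intro z _ hz
      simp [pmass_notMem μ Z z hz]
  rw [this, chain h, chain h, chain h]
  ring

theorem indep_comp {S' T' : Type*} [Fintype S] [Fintype T] {μ : Ω → ℝ} {X : Ω → S} {Y : Ω → T}
    (hi : IndepPair μ X Y) (f : S → S') (g : T → T') :
    IndepPair μ (fun ω => f (X ω)) (fun ω => g (Y ω)) := by
  intro s t
  have := pmass_comp μ (fun ω => (X ω, Y ω)) (fun p : S × T => (f p.1, g p.2)) (s, t)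
  rw [this, pmass_comp μ X f, pmass_comp μ Y g, Finset.sum_mul_sum, Fintype.sum_prod_type]
  apply Finset.sum_congr rfl; intro a _
  apply Finset.sum_congr rfl; intro b _
  rw [hi]
  by_cases h1 : f a = s <;> by_cases h2 : g b = t <;> simp [h1, h2]

theorem indep_ident {Ω₁ Ω₂ : Type*} [Fintype Ω₁] [Fintype Ω₂] {μ : Ω → ℝ} {μ₁ : Ω₁ → ℝ}
    {μ₂ : Ω₂ → ℝ} {X : Ω → S} {Y : Ω → T} {X' : Ω₁ → S} {Y' : Ω₂ → T} (hi : IndepPair μ X Y)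
    (h1 : IdentDist μ X μ₁ X') (h2 : IdentDist μ Y μ₂ Y') :
    IdentDist μ (fun ω => (X ω, Y ω)) (fun p : Ω₁ × Ω₂ => μ₁ p.1 * μ₂ p.2)
      (fun p => (X' p.1, Y' p.2)) := by
  rintro ⟨s, t⟩
  rw [hi, pmass_prod, h1, h2]

theorem four_fst {V : Type*} [Fintype U] [Fintype V] {μ : Ω → ℝ} (h : IsProb μ)
    {X : Ω → S} {Y : Ω → T} {Z : Ω → U} {W : Ω → V} (hi : IndepFour μ X Y Z W) :
    IndepPair μ X Y := by
  intro s t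
  rw [pmass_fst_sum μ (fun ω => (X ω, Y ω)) (fun ω => (Z ω, W ω)), Fintype.sum_prod_type]
  have : ∀ u v, pmass μ (fun ω => ((X ω, Y ω), (Z ω, W ω))) ((s, t), (u, v))
      = pmass μ X s * pmass μ Y t * pmass μ Z u * pmass μ W v := by
    intro u v
    rw [← hi s t u v]
    simp only [pmass, Prod.mk.injEq, and_assoc]
  simp only [this, ← Finset.mul_sum, pmass_sum, h.2, mul_one]

theorem four_pair {V : Type*} [Fintype S] [Fintype T] [Fintype U] [Fintype V] {μ : Ω → ℝ}
    (h : IsProb μ)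
    {X : Ω → S} {Y : Ω → T} {Z : Ω → U} {W : Ω → V} (hi : IndepFour μ X Y Z W) :
    IndepPair μ (fun ω => (X ω, Y ω)) (fun ω => (Z ω, W ω)) := by
  have hi' : IndepFour μ Z W X Y := by
    intro u v s t
    have := hi s t u v
    trans pmass μ X s * pmass μ Y t * pmass μ Z u * pmass μ W v
    · rw [← this]
      simp only [pmass, Prod.mk.injEq]
      apply Finset.sum_congr rfl
      intro ω _
      congr 1
      apply propext
      tauto
    · ring
  rintro ⟨s, t⟩ ⟨u, v⟩
  rw [four_fst h hi, four_fst h hi']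
  have := hi s t u v
  rw [← mul_assoc, ← this]
  simp only [pmass, Prod.mk.injEq, and_assoc]

theorem four_perm {V : Type*} {μ : Ω → ℝ}
    {X : Ω → S} {Y : Ω → T} {Z : Ω → U} {W : Ω → V} (hi : IndepFour μ X Y Z W) :
    IndepFour μ X W Z Y ∧ IndepFour μ Z Y X W ∧ IndepFour μ Z W X Y := by
  have key : ∀ (s : S) (t : T) (u : U) (v : V), 
     (pmass μ (fun ω => (X ω, W ω, Z ω, Y ω)) (s, v, u, t)
      = pmass μ (fun ω => (X ω, Y ω, Z ω, W ω)) (s, t, u, v)) ∧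
     (pmass μ (fun ω => (Z ω, Y ω, X ω, W ω)) (u, t, s, v)
      = pmass μ (fun ω => (X ω, Y ω, Z ω, W ω)) (s, t, u, v)) ∧
     (pmass μ (fun ω => (Z ω, W ω, X ω, Y ω)) (u, v, s, t)
      = pmass μ (fun ω => (X ω, Y ω, Z ω, W ω)) (s, t, u, v)) := by
    intro s t u v
    simp only [pmass, Prod.mk.injEq]
    refine ⟨?_, ?_, ?_⟩ <;>
    · apply Finset.sum_congr rfl
      intro ω _
      congr 1
      apply propext
      tauto
  refine ⟨?_, ?_, ?_⟩
  · intro s v u t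
    rw [(key s t u v).1, hi]; ring
  · intro u t s v
    rw [(key s t u v).2.1, hi]; ring
  · intro u v s t
    rw [(key s t u v).2.2, hi]; ring

/-- averaged distance, conditioning both variables -/
theorem cond_prod (μ : Ω₁ → ℝ) (ν : Ω₂ → ℝ) (A : Ω₁ → S) (B : Ω₂ → T) (a : S) (b : T) :
    (fun p : Ω₁ × Ω₂ => condMeas μ A a p.1 * condMeas ν B b p.2)
      = condMeas (fun p : Ω₁ × Ω₂ => μ p.1 * ν p.2) (fun p => (A p.1, B p.2)) (a, b) := by
  funext p
  simp only [condMeas, pmass_prod, Prod.mk.injEq]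
  by_cases h1 : A p.1 = a <;> by_cases h2 : B p.2 = b <;> simp [h1, h2]
  ring

theorem cond_snd {μ : Ω₁ → ℝ} (hμ : IsProb μ) (ν : Ω₂ → ℝ) (B : Ω₂ → T) (b : T) :
    (fun p : Ω₁ × Ω₂ => μ p.1 * condMeas ν B b p.2)
      = condMeas (fun p : Ω₁ × Ω₂ => μ p.1 * ν p.2) (fun p => B p.2) b := by
  funext p
  simp only [condMeas, pmass_snd hμ]
  by_cases h2 : B p.2 = b <;> simp [h2]
  ring

theorem avg_right {G : Type*} [AddCommGroup G] [Fintype G] [Fintype T]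
    {μ : Ω₁ → ℝ} (hμ : IsProb μ) {ν : Ω₂ → ℝ} (hν : IsProb ν)
    (X : Ω₁ → G) (Y : Ω₂ → G) (B : Ω₂ → T) :
    ∑ b, pmass ν B b * rdist μ X (condMeas ν B b) Y
      ≤ rdist μ X ν Y + ent ν Y / 2 - cE ν Y B / 2 := by
  have h1 := cE_le (isProb_prod hμ hν) (fun p => X p.1 - Y p.2) (fun p => B p.2)
  have h2 : ∑ b, pmass ν B b * rdist μ X (condMeas ν B b) Y
     = cE (fun p : Ω₁ × Ω₂ => μ p.1 * ν p.2) (fun p => X p.1 - Y p.2) (fun p => B p.2)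
       - ent μ X / 2 - cE ν Y B / 2 := by
    have hs : ent μ X / 2 = ∑ b, pmass ν B b * (ent μ X / 2) := by
      rw [← Finset.sum_mul, pmass_sum, hν.2, one_mul]
    rw [hs]
    unfold cE
    rw [Finset.sum_div, ← Finset.sum_sub_distrib, ← Finset.sum_sub_distrib]
    apply Finset.sum_congr rfl
    intro b _
    rw [rdist, cond_snd hμ, pmass_snd hμ]
    ring
  rw [h2]
  unfold rdist
  linarith

theorem avg_both {G : Type*} [AddCommGroup G] [Fintype G] [Fintype S] [Fintype T]
    {μ : Ω₁ → ℝ} (hμ : IsProb μ) {ν : Ω₂ → ℝ} (hν : IsProb ν)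
    (X : Ω₁ → G) (A : Ω₁ → S) (Y : Ω₂ → G) (B : Ω₂ → T) :
    ∑ a, ∑ b, pmass μ A a * pmass ν B b * rdist (condMeas μ A a) X (condMeas ν B b) Y
      = cE (fun p : Ω₁ × Ω₂ => μ p.1 * ν p.2) (fun p => X p.1 - Y p.2) (fun p => (A p.1, B p.2))
       - cE μ X A / 2 - cE ν Y B / 2 := by
  have hs : cE μ X A / 2 = ∑ a, ∑ b, pmass μ A a * pmass ν B b * (ent (condMeas μ A a) X / 2) := by
    rw [cE, Finset.sum_div]
    apply Finset.sum_congr rfl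
    intro a _
    rw [← Finset.sum_mul, ← Finset.mul_sum, pmass_sum, hν.2]; ring
  have hs' : cE ν Y B / 2
      = ∑ a, ∑ b, pmass μ A a * pmass ν B b * (ent (condMeas ν B b) Y / 2) := by
    rw [Finset.sum_comm, cE, Finset.sum_div]
    apply Finset.sum_congr rfl
    intro a _
    rw [← Finset.sum_mul, ← Finset.sum_mul, pmass_sum, hμ.2]; ring
  rw [hs, hs']
  unfold cE
  rw [Fintype.sum_prod_type]
  simp only [← Finset.sum_sub_distrib]
  apply Finset.sum_congr rfl
  intro a _
  apply Finset.sum_congr rfl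
  intro b _
  rw [rdist, cond_prod, pmass_prod]
  ring

theorem sub_eq_add' {n : ℕ} (a b : Fin n → ZMod 2) : a - b = a + b := by
  funext i
  exact CharTwo.sub_eq_add _ _

end helpers

/-- **The bound (5.5) on `H[S]`.** In the setting of the first estimate (with `η = 1/9`,
`(X₁, X₂)` a `τ`-minimizer, `X̃₁, X̃₂` independent copies, `k := d[X₁;X₂]`, and
`I₁ := I[X₁ + X₂ : X̃₁ + X₂ | X₁ + X₂ + X̃₁ + X̃₂]`):
`H[X₁ + X₂ + X̃₁ + X̃₂] ≤ H[X₁]/2 + H[X₂]/2 + (2 + η) k - I₁`. -/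
theorem sum_entropy_bound {n : ℕ} {Ω₀₁ Ω₀₂ Ω : Type} [Fintype Ω₀₁] [Fintype Ω₀₂] [Fintype Ω]
    (μ₀₁ : Ω₀₁ → ℝ) (μ₀₂ : Ω₀₂ → ℝ) (μ : Ω → ℝ)
    (hμ₀₁ : IsProb μ₀₁) (hμ₀₂ : IsProb μ₀₂) (hμ : IsProb μ)
    (X₀₁ : Ω₀₁ → (Fin n → ZMod 2)) (X₀₂ : Ω₀₂ → (Fin n → ZMod 2))
    (X₁ X₂ Y₁ Y₂ : Ω → (Fin n → ZMod 2))
    (hindep : IndepFour μ X₁ X₂ Y₁ Y₂)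
    (hY₁ : IdentDist μ Y₁ μ X₁) (hY₂ : IdentDist μ Y₂ μ X₂)
    (k : ℝ) (hk : rdist μ X₁ μ X₂ = k)
    (hmin : ∀ (Ω₁' : Type) [Fintype Ω₁'] (Ω₂' : Type) [Fintype Ω₂']
      (μ₁' : Ω₁' → ℝ) (μ₂' : Ω₂' → ℝ), IsProb μ₁' → IsProb μ₂' →
      ∀ (X₁' : Ω₁' → (Fin n → ZMod 2)) (X₂' : Ω₂' → (Fin n → ZMod 2)),
        rdist μ X₁ μ X₂ + (1/9) * rdist μ₀₁ X₀₁ μ X₁ + (1/9) * rdist μ₀₂ X₀₂ μ X₂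
          ≤ rdist μ₁' X₁' μ₂' X₂' + (1/9) * rdist μ₀₁ X₀₁ μ₁' X₁'
            + (1/9) * rdist μ₀₂ X₀₂ μ₂' X₂') :
    ent μ (fun ω => X₁ ω + X₂ ω + Y₁ ω + Y₂ ω)
      ≤ ent μ X₁ / 2 + ent μ X₂ / 2 + (2 + 1/9) * k
        - condMutualInfo μ (fun ω => X₁ ω + X₂ ω) (fun ω => Y₁ ω + X₂ ω)
            (fun ω => X₁ ω + X₂ ω + Y₁ ω + Y₂ ω) := by
  classical
  obtain ⟨hp1, hp2, hp3⟩ := four_perm hindep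
  let A : Ω → (Fin n → ZMod 2) := fun ω => X₁ ω + Y₂ ω
  let B : Ω → (Fin n → ZMod 2) := fun ω => Y₁ ω + X₂ ω
  let P : Ω × Ω → ℝ := fun p => μ p.1 * μ p.2
  have hP : IsProb P := isProb_prod hμ hμ
  set H1 := ent μ X₁ with hH1
  set H2 := ent μ X₂ with hH2
  have eY1 : ent μ Y₁ = H1 := ident_ent hY₁
  have eY2 : ent μ Y₂ = H2 := ident_ent hY₂
  have hX1 : IdentDist μ X₁ μ X₁ := fun _ => rfl
  have hX2 : IdentDist μ X₂ μ X₂ := fun _ => rfl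
  set h := ent P (fun p => X₁ p.1 - X₂ p.2) with hh
  have hkh : k = h - H1 / 2 - H2 / 2 := hk.symm
  have gen : ∀ U V : Ω → (Fin n → ZMod 2), IndepPair μ U V → IdentDist μ U μ X₁ → IdentDist μ V μ X₂ →
      ent μ (fun ω => U ω + V ω) = h := by
    intro U V hUV hU hV
    have := ident_ent (ident_comp (indep_ident hUV hU hV) (fun q : (Fin n → ZMod 2) × (Fin n → ZMod 2) => q.1 - q.2))
    rw [hh, ← this]
    simp only [sub_eq_add']
  have e12 : ent μ (fun ω => X₁ ω + X₂ ω) = h := gen _ _ (four_fst hμ hindep) hX1 hX2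
  have eA : ent μ A = h := gen _ _ (four_fst hμ hp1) hX1 hY₂
  have eB : ent μ B = h := gen _ _ (four_fst hμ hp2) hY₁ hX2
  have eYY : ent μ (fun ω => Y₁ ω + Y₂ ω) = h := gen _ _ (four_fst hμ hp3) hY₁ hY₂
  have hAB : IndepPair μ (fun ω => (X₁ ω, Y₂ ω)) (fun ω => (Y₁ ω, X₂ ω)) := four_pair hμ hp1
  have hZ : IndepPair μ (fun ω => (X₁ ω, X₂ ω)) (fun ω => (Y₁ ω, Y₂ ω)) := four_pair hμ hindep
  have eAB : ent μ (fun ω => (A ω, B ω)) = h + h := by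
    have := ent_indep hμ _ _ (indep_comp hAB (fun q : (Fin n → ZMod 2) × (Fin n → ZMod 2) => q.1 + q.2)
      (fun q : (Fin n → ZMod 2) × (Fin n → ZMod 2) => q.1 + q.2))
    rw [this]
    exact congrArg₂ (· + ·) eA eB
  have eZ : ent μ (fun ω => (X₁ ω + X₂ ω, Y₁ ω + Y₂ ω)) = h + h := by
    have := ent_indep hμ _ _ (indep_comp hZ (fun q : (Fin n → ZMod 2) × (Fin n → ZMod 2) => q.1 + q.2)
      (fun q : (Fin n → ZMod 2) × (Fin n → ZMod 2) => q.1 + q.2))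
    rw [this]
    exact congrArg₂ (· + ·) e12 eYY
  have eX1A : ent μ (fun ω => (X₁ ω, A ω)) = H1 + H2 := by
    rw [← eY2, hH1, ← ent_indep hμ _ _ (four_fst hμ hp1)]
    apply ent_iff
    intro ω ω'
    simp only [A, Prod.mk.injEq]
    constructor
    · rintro ⟨h1, h2⟩; rw [h1] at h2; exact ⟨h1, add_left_cancel h2⟩
    · rintro ⟨h1, h2⟩; rw [h1, h2]; exact ⟨rfl, rfl⟩
  have eX2B : ent μ (fun ω => (X₂ ω, B ω)) = H1 + H2 := by
    rw [← eY1, hH2, ← ent_indep hμ _ _ (four_fst hμ hp2)]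
    apply ent_iff
    intro ω ω'
    simp only [B, Prod.mk.injEq]
    constructor
    · rintro ⟨h1, h2⟩; rw [h1] at h2; exact ⟨add_right_cancel h2, h1⟩
    · rintro ⟨h1, h2⟩; rw [h1, h2]; exact ⟨rfl, rfl⟩
  set S : Ω → (Fin n → ZMod 2) := fun ω => X₁ ω + X₂ ω + Y₁ ω + Y₂ ω with hS
  have e1 : ent μ (fun ω => (X₁ ω + X₂ ω, S ω)) = h + h := by
    rw [← eZ]
    apply ent_iff
    intro ω ω'
    simp only [hS, Prod.mk.injEq, add_assoc (X₁ _ + X₂ _)]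
    constructor
    · rintro ⟨h1, h2⟩; rw [h1] at h2; exact ⟨h1, add_left_cancel h2⟩
    · rintro ⟨h1, h2⟩; rw [h1, h2]; exact ⟨rfl, rfl⟩
  have hSAB : ∀ ω, S ω = A ω + B ω := by
    intro ω; simp only [hS, A, B]; abel
  have e2 : ent μ (fun ω => (Y₁ ω + X₂ ω, S ω)) = h + h := by
    rw [← eAB]
    apply ent_iff
    intro ω ω'
    simp only [hSAB, Prod.mk.injEq]
    change (B ω = B ω' ∧ _) ↔ _
    constructor
    · rintro ⟨h1, h2⟩; rw [h1] at h2; exact ⟨add_right_cancel h2, h1⟩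
    · rintro ⟨h1, h2⟩; rw [h1, h2]; exact ⟨rfl, rfl⟩
  set H3 := ent μ (fun ω => (X₁ ω + X₂ ω, (A ω, B ω))) with hH3
  have e3 : ent μ (fun ω => ((X₁ ω + X₂ ω, Y₁ ω + X₂ ω), S ω)) = H3 := by
    apply ent_iff
    intro ω ω'
    simp only [hSAB, Prod.mk.injEq]
    change ((_ ∧ B ω = B ω') ∧ _) ↔ _
    constructor
    · rintro ⟨⟨h0, h1⟩, h2⟩; rw [h1] at h2; exact ⟨h0, add_right_cancel h2, h1⟩
    · rintro ⟨h0, h1, h2⟩; rw [h1, h2]; exact ⟨⟨h0, rfl⟩, rfl⟩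
  have hI := condMI hμ (fun ω => X₁ ω + X₂ ω) (fun ω => Y₁ ω + X₂ ω) S
  rw [e1, e2, e3] at hI
  -- the product space
  have hid : IdentDist μ (fun ω => ((X₁ ω, Y₂ ω), (Y₁ ω, X₂ ω))) P
      (fun p => ((X₁ p.1, Y₂ p.1), (Y₁ p.2, X₂ p.2))) :=
    indep_ident hAB (fun _ => rfl) (fun _ => rfl)
  have f3 : ent P (fun p => (X₁ p.1 - X₂ p.2, (A p.1, B p.2))) = H3 := by
    have := ident_ent (ident_comp hid (fun q : ((Fin n → ZMod 2) × (Fin n → ZMod 2)) × ((Fin n → ZMod 2) × (Fin n → ZMod 2)) =>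
      (q.1.1 - q.2.2, (q.1.1 + q.1.2, q.2.1 + q.2.2))))
    rw [hH3]
    simp only [sub_eq_add'] at this ⊢
    exact this.symm
  have f2 : ent P (fun p => (A p.1, B p.2)) = h + h := by
    have := ident_ent (ident_comp hid (fun q : ((Fin n → ZMod 2) × (Fin n → ZMod 2)) × ((Fin n → ZMod 2) × (Fin n → ZMod 2)) =>
      (q.1.1 + q.1.2, q.2.1 + q.2.2)))
    rw [← eAB]
    exact this.symm
  have c3 := chain hP (fun p => X₁ p.1 - X₂ p.2) (fun p => (A p.1, B p.2))
  rw [f3, f2] at c3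
  have cA := chain hμ X₁ A
  rw [eX1A, eA] at cA
  have cB := chain hμ X₂ B
  rw [eX2B, eB] at cB
  have hboth := avg_both hμ hμ X₁ A X₂ B
  have hr1 := avg_right hμ₀₁ hμ X₀₁ X₁ A
  have hr2 := avg_right hμ₀₂ hμ X₀₂ X₂ B
  set D1 := rdist μ₀₁ X₀₁ μ X₁
  set D2 := rdist μ₀₂ X₀₂ μ X₂
  have hsum : ∑ a, ∑ b, pmass μ A a * pmass μ B b * (k + (1/9) * D1 + (1/9) * D2)
      ≤ ∑ a, ∑ b, pmass μ A a * pmass μ B b * (rdist (condMeas μ A a) X₁ (condMeas μ B b) X₂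
          + (1/9) * rdist μ₀₁ X₀₁ (condMeas μ A a) X₁
          + (1/9) * rdist μ₀₂ X₀₂ (condMeas μ B b) X₂) := by
    apply Finset.sum_le_sum; intro a _
    apply Finset.sum_le_sum; intro b _
    by_cases ha : pmass μ A a = 0
    · simp [ha]
    by_cases hb : pmass μ B b = 0
    · simp [hb]
    apply mul_le_mul_of_nonneg_left _
      (mul_nonneg (pmass_nonneg' hμ.1 _ _) (pmass_nonneg' hμ.1 _ _))
    rw [← hk]
    exact hmin Ω Ω _ _ (isProb_cond hμ A a ha) (isProb_cond hμ B b hb) X₁ X₂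
  have hsl : ∑ a, ∑ b, pmass μ A a * pmass μ B b * (k + (1/9) * D1 + (1/9) * D2)
      = k + (1/9) * D1 + (1/9) * D2 := by
    simp only [← Finset.sum_mul, ← Finset.mul_sum, pmass_sum, hμ.2, one_mul]
  have hsr : ∑ a, ∑ b, pmass μ A a * pmass μ B b * (rdist (condMeas μ A a) X₁ (condMeas μ B b) X₂
          + (1/9) * rdist μ₀₁ X₀₁ (condMeas μ A a) X₁
          + (1/9) * rdist μ₀₂ X₀₂ (condMeas μ B b) X₂)
      = (∑ a, ∑ b, pmass μ A a * pmass μ B b * rdist (condMeas μ A a) X₁ (condMeas μ B b) X₂)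
        + (1/9) * ∑ a, pmass μ A a * rdist μ₀₁ X₀₁ (condMeas μ A a) X₁
        + (1/9) * ∑ b, pmass μ B b * rdist μ₀₂ X₀₂ (condMeas μ B b) X₂ := by
    simp only [mul_add, Finset.sum_add_distrib]
    congr 1
    · congr 1
      rw [Finset.mul_sum]
      apply Finset.sum_congr rfl; intro a _
      rw [← Finset.sum_mul, ← Finset.mul_sum, pmass_sum, hμ.2]; ring
    · rw [Finset.sum_comm, Finset.mul_sum]
      apply Finset.sum_congr rfl; intro b _
      rw [← Finset.sum_mul, ← Finset.sum_mul, pmass_sum, hμ.2]; ring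
  rw [hsl, hsr, hboth] at hsum
  change cE P _ _ = _ at c3
  rw [show cE (fun p : Ω × Ω => μ p.1 * μ p.2) (fun p => X₁ p.1 - X₂ p.2)
    (fun p => (A p.1, B p.2)) = H3 - (h + h) from c3] at hsum
  rw [hI]
  rw [cA] at hsum hr1
  rw [cB] at hsum hr2
  linarith

end
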